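/- arXiv:1704.07773 — 6 statements merged into one kernel-verified Lean document; each statement's English description precedes it below -/
import Mathlib

section
/- Consider the deterministic MPC setting with horizon N ≥ 1. Suppose Assumption 1 holds (for every x ∈ X there exists u ∈ U with c(x,u) + c_N(f(x,u)) ≤ c_N(x)), and let μ : X → U be an MPC policy for horizon N, i.e. c(x,μ(x)) + J_{N-1}^⋆(f(x,μ(x))) = J_N^⋆(x) for all x ∈ X. Then for every x ∈ X: J_∞^⋆(x) ≤ J_∞(x,μ_MPC) ≤ J_N^⋆(x), where J_∞(x,μ_MPC) is the infinite-horizon cost of the closed-loop trajectory generated by repeatedly applying μ. -/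
open scoped ENNReal

noncomputable section

variable {X U : Type*}

/-- Open-loop trajectory: `x_{k+1} = f(x_k, u_k)`. -/
def traj (f : X → U → X) (x0 : X) (u : ℕ → U) : ℕ → X
  | 0 => x0
  | k + 1 => f (traj f x0 u k) (u k)

/-- `N`-horizon cost `J_N(x0, u) = Σ_{k=0}^{N-1} c(x_k,u_k) + c_N(x_N)`. -/
def costN (f : X → U → X) (c : X → U → NNReal) (cT : X → NNReal)
    (N : ℕ) (x0 : X) (u : ℕ → U) : ℝ≥0∞ :=
  (∑ k ∈ Finset.range N, (c (traj f x0 u k) (u k) : ℝ≥0∞)) +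
    (cT (traj f x0 u N) : ℝ≥0∞)

/-- Finite-horizon optimal value function `J_N^⋆(x) = inf_u J_N(x,u)`. -/
def valN (f : X → U → X) (c : X → U → NNReal) (cT : X → NNReal)
    (N : ℕ) (x : X) : ℝ≥0∞ :=
  ⨅ u : ℕ → U, costN f c cT N x u

/-- Infinite-horizon cost `J_∞(x0, u) = Σ_{k=0}^∞ c(x_k,u_k) ∈ [0,∞]`. -/
def costInf (f : X → U → X) (c : X → U → NNReal) (x0 : X) (u : ℕ → U) : ℝ≥0∞ :=
  ∑' k, (c (traj f x0 u k) (u k) : ℝ≥0∞)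

/-- Infinite-horizon optimal value function `J_∞^⋆(x) = inf_u J_∞(x,u)`. -/
def valInf (f : X → U → X) (c : X → U → NNReal) (x : X) : ℝ≥0∞ :=
  ⨅ u : ℕ → U, costInf f c x u

/-- Closed-loop trajectory under repeated application of policy `μ`. -/
def clTraj (f : X → U → X) (μ : X → U) (x0 : X) : ℕ → X
  | 0 => x0
  | k + 1 => f (clTraj f μ x0 k) (μ (clTraj f μ x0 k))

/-- Achieved infinite-horizon MPC cost `J_∞(x0, μ_MPC)`. -/
def clCost (f : X → U → X) (c : X → U → NNReal) (μ : X → U) (x0 : X) : ℝ≥0∞ :=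
  ∑' k, (c (clTraj f μ x0 k) (μ (clTraj f μ x0 k)) : ℝ≥0∞)

theorem valN_succ_le_aux (f : X → U → X) (c : X → U → NNReal) (cT : X → NNReal)
    (hassm : ∀ x : X, ∃ u : U, c x u + cT (f x u) ≤ cT x) (N : ℕ) (x : X) :
    valN f c cT (N + 1) x ≤ valN f c cT N x := by
  refine le_iInf fun u => ?_
  obtain ⟨v, hv⟩ := hassm (traj f x u N)
  let w : ℕ → U := fun k => if k < N then u k else v
  have hw : ∀ k, k < N → w k = u k := fun k hk => if_pos hk
  have hwN : w N = v := if_neg (lt_irrefl N)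
  have ht : ∀ k, k ≤ N → traj f x w k = traj f x u k := by
    intro k
    induction k with
    | zero => intro _; rfl
    | succ k ih =>
      intro hk
      simp only [traj]
      rw [ih (by omega), hw k (by omega)]
  refine (iInf_le _ w).trans ?_
  have hs : ∑ k ∈ Finset.range N, (c (traj f x w k) (w k) : ℝ≥0∞)
      = ∑ k ∈ Finset.range N, (c (traj f x u k) (u k) : ℝ≥0∞) := by
    refine Finset.sum_congr rfl fun k hk => ?_
    have hk := Finset.mem_range.1 hk
    rw [ht k hk.le, hw k hk]
  have hT : traj f x w (N + 1) = f (traj f x u N) v := by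
    simp only [traj]
    rw [ht N le_rfl, hwN]
  unfold costN
  rw [Finset.sum_range_succ, hs, hT, ht N le_rfl, hwN, add_assoc]
  gcongr
  exact_mod_cast hv

/-- Performance of deterministic MPC (Theorem 1):
under the terminal-cost contraction assumption, for an MPC policy `μ` of horizon `N ≥ 1`,
`J_∞^⋆(x) ≤ J_∞(x, μ_MPC) ≤ J_N^⋆(x)`. -/
theorem stmt_0 [Nonempty X] [Nonempty U]
    (f : X → U → X) (c : X → U → NNReal) (cT : X → NNReal)
    (N : ℕ) (hN : 1 ≤ N)
    (hassm : ∀ x : X, ∃ u : U, c x u + cT (f x u) ≤ cT x)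
    (μ : X → U)
    (hμ : ∀ x : X,
      (c x (μ x) : ℝ≥0∞) + valN f c cT (N - 1) (f x (μ x)) = valN f c cT N x)
    (x : X) :
    valInf f c x ≤ clCost f c μ x ∧ clCost f c μ x ≤ valN f c cT N x := by
  constructor
  · refine (iInf_le _ fun k => μ (clTraj f μ x k)).trans (le_of_eq ?_)
    have ht : ∀ k, traj f x (fun k => μ (clTraj f μ x k)) k = clTraj f μ x k := by
      intro k
      induction k with
      | zero => rfl
      | succ k ih => simp only [traj, clTraj, ih]
    simp only [costInf, clCost, ht]
  · have hstep : ∀ y, (c y (μ y) : ℝ≥0∞) + valN f c cT N (f y (μ y)) ≤ valN f c cT N y := by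
      intro y
      rw [← hμ y]
      gcongr
      have h := valN_succ_le_aux f c cT hassm (N - 1) (f y (μ y))
      rwa [Nat.sub_add_cancel hN] at h
    have hsum : ∀ n, ∑ k ∈ Finset.range n,
        (c (clTraj f μ x k) (μ (clTraj f μ x k)) : ℝ≥0∞) + valN f c cT N (clTraj f μ x n)
          ≤ valN f c cT N x := by
      intro n
      induction n with
      | zero => simp [clTraj]
      | succ n ih =>
        refine le_trans ?_ ih
        rw [Finset.sum_range_succ, add_assoc]
        gcongr
        exact hstep _
    unfold clCost
    rw [ENNReal.tsum_eq_iSup_nat]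
    exact iSup_le fun n => le_self_add.trans (hsum n)
end
end

section
/- Lemma 1 (performance of SMPC for POMDPs). In the POMDP control setting with horizon N ≥ 1 and discount α ∈ [0,1), let μ : Δ(S) → A be an MPC policy for horizon N (i.e. μ(π) attains the minimum in the dynamic-programming recursion defining J_N^⋆(π) for every π). Suppose there exist γ ∈ [0,1] and η ≥ 0 such that for every belief π ∈ Δ(S): Σ_θ σ(π,μ(π),θ) [ J_N^⋆(T(π,μ(π),θ)) − J_{N-1}^⋆(T(π,μ(π),θ)) ] ≤ γ Σ_i π_i c(μ(π))_i + η. Then for every π ∈ Δ(S): (1 − αγ) J_∞^⋆(π) ≤ (1 − αγ) J_∞(π,μ_MPC) ≤ J_N^⋆(π) + (α/(1−α)) η, where J_∞(π,μ_MPC) is the infinite-horizon discounted closed-loop cost of the stationary policy μ and J_∞^⋆(π) is the infimum of J_∞(π,g) over all stationary belief policies g. -/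
open scoped ENNReal

noncomputable section

variable {S A O : Type*}

/-- Observation likelihood `σ(π,a,θ) = Σ_{i,j} π_i P(a)_{ij} R(a)_{jθ}`. -/
def lik [Fintype S] (P : A → S → S → ℝ) (R : A → S → O → ℝ)
    (π : S → ℝ) (a : A) (θ : O) : ℝ :=
  ∑ i, ∑ j, π i * P a i j * R a j θ

/-- Bayesian belief update `T(π,a,θ)`; by convention `T(π,a,θ) = π` when `σ(π,a,θ) = 0`. -/
def upd [Fintype S] (P : A → S → S → ℝ) (R : A → S → O → ℝ)
    (π : S → ℝ) (a : A) (θ : O) : S → ℝ :=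
  if 0 < lik P R π a θ then
    fun j => (∑ i, π i * P a i j * R a j θ) / lik P R π a θ
  else π

/-- Finite-horizon optimal value functions by dynamic programming:
`J_0^⋆(π) = π cT`, `J_{k+1}^⋆(π) = min_a [π c(a) + α Σ_θ σ(π,a,θ) J_k^⋆(T(π,a,θ))]`. -/
def Jstar [Fintype S] [Fintype O] (P : A → S → S → ℝ) (R : A → S → O → ℝ)
    (c : A → S → ℝ) (cT : S → ℝ) (α : ℝ) : ℕ → (S → ℝ) → ℝ
  | 0, π => ∑ j, π j * cT j
  | k + 1, π => ⨅ a : A, (∑ i, π i * c a i +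
      α * ∑ θ, lik P R π a θ * Jstar P R c cT α k (upd P R π a θ))

/-- `M`-step closed-loop cost of the stationary belief policy `g`. -/
def Vcl [Fintype S] [Fintype O] (P : A → S → S → ℝ) (R : A → S → O → ℝ)
    (c : A → S → ℝ) (α : ℝ) (g : (S → ℝ) → A) : ℕ → (S → ℝ) → ℝ
  | 0, _ => 0
  | M + 1, π => ∑ i, π i * c (g π) i +
      α * ∑ θ, lik P R π (g π) θ * Vcl P R c α g M (upd P R π (g π) θ)

/-- Infinite-horizon discounted closed-loop cost `J_∞(π,g) = sup_M V_M^g(π) ∈ [0,∞]`. -/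
def Jinf [Fintype S] [Fintype O] (P : A → S → S → ℝ) (R : A → S → O → ℝ)
    (c : A → S → ℝ) (α : ℝ) (g : (S → ℝ) → A) (π : S → ℝ) : ℝ≥0∞ :=
  ⨆ M, ENNReal.ofReal (Vcl P R c α g M π)

/-- Optimal infinite-horizon value `J_∞^⋆(π) = inf_g J_∞(π,g)` over stationary policies. -/
def JinfStar [Fintype S] [Fintype O] (P : A → S → S → ℝ) (R : A → S → O → ℝ)
    (c : A → S → ℝ) (α : ℝ) (π : S → ℝ) : ℝ≥0∞ :=
  ⨅ g : (S → ℝ) → A, Jinf P R c α g π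

theorem aux_lik_nonneg [Fintype S] (P : A → S → S → ℝ) (R : A → S → O → ℝ)
    (hP : ∀ a i, (∀ j, 0 ≤ P a i j)) (hR : ∀ a j, (∀ θ, 0 ≤ R a j θ))
    (π : S → ℝ) (hπ : ∀ i, 0 ≤ π i) (a : A) (θ : O) : 0 ≤ lik P R π a θ :=
  Finset.sum_nonneg fun i _ => Finset.sum_nonneg fun j _ =>
    mul_nonneg (mul_nonneg (hπ i) (hP a i j)) (hR a j θ)

theorem aux_lik_sum [Fintype S] [Fintype O] (P : A → S → S → ℝ) (R : A → S → O → ℝ)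
    (hP : ∀ a i, ∑ j, P a i j = 1) (hR : ∀ a j, ∑ θ, R a j θ = 1)
    (π : S → ℝ) (hπ : ∑ i, π i = 1) (a : A) : ∑ θ, lik P R π a θ = 1 := by
  unfold lik
  rw [Finset.sum_comm, ← hπ]
  refine Finset.sum_congr rfl fun i _ => ?_
  rw [Finset.sum_comm]
  simp_rw [← Finset.mul_sum, hR, mul_one]
  rw [← Finset.mul_sum, hP, mul_one]

theorem aux_upd_mem [Fintype S] (P : A → S → S → ℝ) (R : A → S → O → ℝ)
    (hP : ∀ a i, (∀ j, 0 ≤ P a i j)) (hR : ∀ a j, (∀ θ, 0 ≤ R a j θ))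
    (π : S → ℝ) (hπ : π ∈ stdSimplex ℝ S) (a : A) (θ : O) :
    upd P R π a θ ∈ stdSimplex ℝ S := by
  unfold upd
  split_ifs with h
  · refine ⟨fun j => div_nonneg (Finset.sum_nonneg fun i _ =>
      mul_nonneg (mul_nonneg (hπ.1 i) (hP a i j)) (hR a j θ)) h.le, ?_⟩
    rw [← Finset.sum_div, Finset.sum_comm]
    exact div_self h.ne'
  · exact hπ

theorem aux_J_nonneg [Fintype S] [Fintype O] (P : A → S → S → ℝ) (R : A → S → O → ℝ)
    (hP : ∀ a i, (∀ j, 0 ≤ P a i j)) (hR : ∀ a j, (∀ θ, 0 ≤ R a j θ))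
    (c : A → S → ℝ) (hc : ∀ a i, 0 ≤ c a i)
    (cT : S → ℝ) (hcT : ∀ i, 0 ≤ cT i) (α : ℝ) (hα0 : 0 ≤ α) (k : ℕ) :
    ∀ π ∈ stdSimplex ℝ S, 0 ≤ Jstar P R c cT α k π := by
  induction k with
  | zero =>
    intro π hπ
    exact Finset.sum_nonneg fun j _ => mul_nonneg (hπ.1 j) (hcT j)
  | succ k ih =>
    intro π hπ
    rw [Jstar]
    refine Real.iInf_nonneg fun a => add_nonneg
      (Finset.sum_nonneg fun j _ => mul_nonneg (hπ.1 j) (hc a j))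
      (mul_nonneg hα0 (Finset.sum_nonneg fun θ _ => mul_nonneg
        (aux_lik_nonneg P R hP hR π hπ.1 a θ) (ih _ (aux_upd_mem P R hP hR π hπ a θ))))

/-- Lemma 1 (performance of SMPC for POMDPs): if the expected value-function increment
along the MPC policy is bounded as `E[J_N^⋆(π₁) − J_{N-1}^⋆(π₁)] ≤ γ E[π₀ c(μ(π₀))] + η`,
then `(1 − αγ) J_∞^⋆(π) ≤ (1 − αγ) J_∞(π,μ_MPC) ≤ J_N^⋆(π) + (α/(1−α)) η`. -/
theorem stmt_7 [Fintype S] [Fintype A] [Fintype O]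
    [Nonempty S] [Nonempty A] [Nonempty O]
    (P : A → S → S → ℝ) (R : A → S → O → ℝ)
    (hP : ∀ a i, (∀ j, 0 ≤ P a i j) ∧ ∑ j, P a i j = 1)
    (hR : ∀ a j, (∀ θ, 0 ≤ R a j θ) ∧ ∑ θ, R a j θ = 1)
    (c : A → S → ℝ) (hc : ∀ a i, 0 ≤ c a i)
    (cT : S → ℝ) (hcT : ∀ i, 0 ≤ cT i)
    (α : ℝ) (hα0 : 0 ≤ α) (hα1 : α < 1)
    (N : ℕ) (hN : 1 ≤ N)
    (μ : (S → ℝ) → A)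
    (hμ : ∀ π ∈ stdSimplex ℝ S,
      Jstar P R c cT α N π = ∑ i, π i * c (μ π) i +
        α * ∑ θ, lik P R π (μ π) θ * Jstar P R c cT α (N - 1) (upd P R π (μ π) θ))
    (γ η : ℝ) (hγ0 : 0 ≤ γ) (hγ1 : γ ≤ 1) (hη : 0 ≤ η)
    (hlem : ∀ π ∈ stdSimplex ℝ S,
      ∑ θ, lik P R π (μ π) θ *
          (Jstar P R c cT α N (upd P R π (μ π) θ) -
            Jstar P R c cT α (N - 1) (upd P R π (μ π) θ)) ≤
        γ * ∑ i, π i * c (μ π) i + η)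
    (π : S → ℝ) (hπ : π ∈ stdSimplex ℝ S) :
    ENNReal.ofReal (1 - α * γ) * JinfStar P R c α π ≤
        ENNReal.ofReal (1 - α * γ) * Jinf P R c α μ π ∧
      ENNReal.ofReal (1 - α * γ) * Jinf P R c α μ π ≤
        ENNReal.ofReal (Jstar P R c cT α N π + α / (1 - α) * η) := by
  have hP0 : ∀ a i, (∀ j, 0 ≤ P a i j) := fun a i => (hP a i).1
  have hR0 : ∀ a i, (∀ j, 0 ≤ R a i j) := fun a i => (hR a i).1
  have hαγ : 0 ≤ 1 - α * γ := by nlinarith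
  have h1α : 0 < 1 - α := by linarith
  have key : ∀ M, ∀ π ∈ stdSimplex ℝ S,
      (1 - α * γ) * Vcl P R c α μ M π ≤ Jstar P R c cT α N π + α / (1 - α) * η := by
    intro M
    induction M with
    | zero =>
      intro π hπ
      have h1 := aux_J_nonneg P R hP0 hR0 c hc cT hcT α hα0 N π hπ
      have h2 : 0 ≤ α / (1 - α) * η := by positivity
      simp only [Vcl, mul_zero]
      linarith
    | succ M ih =>
      intro π hπ
      have hs := aux_lik_sum P R (fun a i => (hP a i).2) (fun a i => (hR a i).2) π hπ.2 (μ π)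
      have h1 : ∑ θ, lik P R π (μ π) θ * ((1 - α * γ) * Vcl P R c α μ M (upd P R π (μ π) θ)) ≤
          ∑ θ, lik P R π (μ π) θ *
            (Jstar P R c cT α N (upd P R π (μ π) θ) + α / (1 - α) * η) :=
        Finset.sum_le_sum fun θ _ => mul_le_mul_of_nonneg_left
          (ih _ (aux_upd_mem P R hP0 hR0 π hπ (μ π) θ))
          (aux_lik_nonneg P R hP0 hR0 π hπ.1 (μ π) θ)
      have h2 := hlem π hπ
      have h3 : ∑ θ, lik P R π (μ π) θ * ((1 - α * γ) * Vcl P R c α μ M (upd P R π (μ π) θ)) =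
          (1 - α * γ) * ∑ θ, lik P R π (μ π) θ * Vcl P R c α μ M (upd P R π (μ π) θ) := by
        rw [Finset.mul_sum]
        exact Finset.sum_congr rfl fun θ _ => by ring
      rw [h3] at h1
      simp only [mul_add, Finset.sum_add_distrib, ← Finset.sum_mul, hs, one_mul] at h1
      simp only [mul_sub, Finset.sum_sub_distrib] at h2
      rw [hμ π hπ, Vcl]
      have h4 := mul_le_mul_of_nonneg_left (h1.trans (add_le_add_left
        (sub_le_iff_le_add.mp h2) _)) hα0
      have h5 : α / (1 - α) * η = α * η + α * (α / (1 - α) * η) := by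
        field_simp
        ring
      linarith
  refine ⟨mul_le_mul_right (iInf_le _ μ) _, ?_⟩
  rw [Jinf, ENNReal.mul_iSup]
  refine iSup_le fun M => ?_
  rw [← ENNReal.ofReal_mul hαγ]
  exact ENNReal.ofReal_le_ofReal (key M π hπ)
end
end

section
/- In the POMDP control setting with horizon N ≥ 1 and discount α ∈ [0,1), let μ : Δ(S) → A be an MPC policy for horizon N, and suppose there exist γ ∈ [0,1] and η ≥ 0 such that for every belief π: Σ_θ σ(π,μ(π),θ)[J_N^⋆(T(π,μ(π),θ)) − J_{N-1}^⋆(T(π,μ(π),θ))] ≤ γ Σ_i π_i c(μ(π))_i + η. Then the M-step closed-loop cost of the MPC policy satisfies, for every M ∈ ℕ and every belief π: (1 − αγ) V_M^μ(π) ≤ J_N^⋆(π) + (Σ_{k=1}^{M} α^k) η. -/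
open scoped ENNReal

noncomputable section

variable {S A O : Type*}

theorem lik_nonneg' [Fintype S] [Fintype O]
    (P : A → S → S → ℝ) (R : A → S → O → ℝ)
    (hP : ∀ a i, (∀ j, 0 ≤ P a i j) ∧ ∑ j, P a i j = 1)
    (hR : ∀ a j, (∀ θ, 0 ≤ R a j θ) ∧ ∑ θ, R a j θ = 1)
    (π : S → ℝ) (hπ : π ∈ stdSimplex ℝ S) (a : A) (θ : O) : 0 ≤ lik P R π a θ :=
  Finset.sum_nonneg fun i _ => Finset.sum_nonneg fun j _ =>
    mul_nonneg (mul_nonneg (hπ.1 i) ((hP a i).1 j)) ((hR a j).1 θ)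

theorem lik_sum' [Fintype S] [Fintype O]
    (P : A → S → S → ℝ) (R : A → S → O → ℝ)
    (hP : ∀ a i, (∀ j, 0 ≤ P a i j) ∧ ∑ j, P a i j = 1)
    (hR : ∀ a j, (∀ θ, 0 ≤ R a j θ) ∧ ∑ θ, R a j θ = 1)
    (π : S → ℝ) (hπ : π ∈ stdSimplex ℝ S) (a : A) : ∑ θ, lik P R π a θ = 1 := by
  unfold lik
  rw [Finset.sum_comm, ← hπ.2]
  refine Finset.sum_congr rfl fun i _ => ?_
  rw [Finset.sum_comm]
  simp_rw [← Finset.mul_sum, (hR a _).2, mul_one, ← Finset.mul_sum, (hP a i).2, mul_one]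

theorem upd_mem' [Fintype S] [Fintype O]
    (P : A → S → S → ℝ) (R : A → S → O → ℝ)
    (hP : ∀ a i, (∀ j, 0 ≤ P a i j) ∧ ∑ j, P a i j = 1)
    (hR : ∀ a j, (∀ θ, 0 ≤ R a j θ) ∧ ∑ θ, R a j θ = 1)
    (π : S → ℝ) (hπ : π ∈ stdSimplex ℝ S) (a : A) (θ : O) :
    upd P R π a θ ∈ stdSimplex ℝ S := by
  unfold upd
  split_ifs with h
  · refine ⟨fun j => div_nonneg (Finset.sum_nonneg fun i _ =>
      mul_nonneg (mul_nonneg (hπ.1 i) ((hP a i).1 j)) ((hR a j).1 θ)) h.le, ?_⟩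
    rw [← Finset.sum_div, Finset.sum_comm]
    exact div_self h.ne'
  · exact hπ

theorem Jstar_nonneg' [Fintype S] [Fintype O]
    (P : A → S → S → ℝ) (R : A → S → O → ℝ)
    (hP : ∀ a i, (∀ j, 0 ≤ P a i j) ∧ ∑ j, P a i j = 1)
    (hR : ∀ a j, (∀ θ, 0 ≤ R a j θ) ∧ ∑ θ, R a j θ = 1)
    (c : A → S → ℝ) (hc : ∀ a i, 0 ≤ c a i)
    (cT : S → ℝ) (hcT : ∀ i, 0 ≤ cT i)
    (α : ℝ) (hα0 : 0 ≤ α) (k : ℕ) :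
    ∀ π ∈ stdSimplex ℝ S, 0 ≤ Jstar P R c cT α k π := by
  induction k with
  | zero => 
    intro π hπ
    exact Finset.sum_nonneg fun j _ => mul_nonneg (hπ.1 j) (hcT j)
  | succ k ih =>
    intro π hπ
    rw [Jstar]
    refine Real.iInf_nonneg fun a => add_nonneg
      (Finset.sum_nonneg fun j _ => mul_nonneg (hπ.1 j) (hc a j))
      (mul_nonneg hα0 (Finset.sum_nonneg fun θ _ => mul_nonneg
        (lik_nonneg' P R hP hR π hπ a θ) (ih _ (upd_mem' P R hP hR π hπ a θ))))

/-- Telescoping bound on the `M`-step closed-loop cost of the MPC policy: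
`(1 − αγ) V_M^μ(π) ≤ J_N^⋆(π) + (Σ_{k=1}^{M} α^k) η`. -/
theorem stmt_9 [Fintype S] [Fintype A] [Fintype O]
    [Nonempty S] [Nonempty A] [Nonempty O]
    (P : A → S → S → ℝ) (R : A → S → O → ℝ)
    (hP : ∀ a i, (∀ j, 0 ≤ P a i j) ∧ ∑ j, P a i j = 1)
    (hR : ∀ a j, (∀ θ, 0 ≤ R a j θ) ∧ ∑ θ, R a j θ = 1)
    (c : A → S → ℝ) (hc : ∀ a i, 0 ≤ c a i)
    (cT : S → ℝ) (hcT : ∀ i, 0 ≤ cT i)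
    (α : ℝ) (hα0 : 0 ≤ α) (hα1 : α < 1)
    (N : ℕ) (hN : 1 ≤ N)
    (μ : (S → ℝ) → A)
    (hμ : ∀ π ∈ stdSimplex ℝ S,
      Jstar P R c cT α N π = ∑ i, π i * c (μ π) i +
        α * ∑ θ, lik P R π (μ π) θ * Jstar P R c cT α (N - 1) (upd P R π (μ π) θ))
    (γ η : ℝ) (hγ0 : 0 ≤ γ) (hγ1 : γ ≤ 1) (hη : 0 ≤ η)
    (hlem : ∀ π ∈ stdSimplex ℝ S,
      ∑ θ, lik P R π (μ π) θ *
          (Jstar P R c cT α N (upd P R π (μ π) θ) -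
            Jstar P R c cT α (N - 1) (upd P R π (μ π) θ)) ≤
        γ * ∑ i, π i * c (μ π) i + η)
    (M : ℕ) (π : S → ℝ) (hπ : π ∈ stdSimplex ℝ S) :
    (1 - α * γ) * Vcl P R c α μ M π ≤
      Jstar P R c cT α N π + (∑ k ∈ Finset.Icc 1 M, α ^ k) * η := by
  induction M generalizing π with
  | zero => simpa [Vcl] using Jstar_nonneg' P R hP hR c hc cT hcT α hα0 N π hπ
  | succ M ih =>
    have hs : ∑ k ∈ Finset.Icc 1 (M + 1), α ^ k
        = α + α * ∑ k ∈ Finset.Icc 1 M, α ^ k := by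
      clear ih
      induction M with
      | zero => simp
      | succ M ihM =>
        have e := Finset.sum_Icc_succ_top (by omega : 1 ≤ M + 1) (fun k => α ^ k)
        rw [Finset.sum_Icc_succ_top (by omega)]
        linear_combination ihM - α * e
    have h1 : ∑ θ, lik P R π (μ π) θ * ((1 - α * γ) * Vcl P R c α μ M (upd P R π (μ π) θ))
        ≤ ∑ θ, lik P R π (μ π) θ * (Jstar P R c cT α N (upd P R π (μ π) θ)
          + (∑ k ∈ Finset.Icc 1 M, α ^ k) * η) :=
      Finset.sum_le_sum fun θ _ => mul_le_mul_of_nonneg_left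
        (ih _ (upd_mem' P R hP hR π hπ _ θ)) (lik_nonneg' P R hP hR π hπ _ θ)
    have h2 := hlem π hπ
    have h3 := hμ π hπ
    simp only [mul_add, mul_sub, Finset.sum_add_distrib, Finset.sum_sub_distrib,
      ← Finset.sum_mul, lik_sum' P R hP hR π hπ, one_mul] at h1 h2
    simp only [mul_left_comm _ (1 - α * γ), ← Finset.mul_sum] at h1
    rw [hs, Vcl, h3]
    have h4 := mul_le_mul_of_nonneg_left h1 hα0
    have h5 := mul_le_mul_of_nonneg_left h2 hα0
    linarith
end
end

section
/- In the POMDP control setting with discount α ∈ (0,1), suppose there exist δ ≥ 0 and a policy g̃ : Δ(S) → A such that for every belief π ∈ Δ(S): α Σ_{i,j} π_i P(g̃(π))_{ij} cT_j ≤ Σ_i π_i (cT_i − c(g̃(π))_i) + δ. Then the dynamic-programming value functions satisfy the approximate-monotonicity bound J_{k+1}^⋆(π) ≤ J_k^⋆(π) + α^k δ for every k ∈ ℕ and every belief π ∈ Δ(S). In particular, under Assumption 3 with constant η ≥ 0 and horizon N ≥ 1 (i.e. δ = η/α^{N−1}), one has J_N^⋆(π) − J_{N−1}^⋆(π) ≤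 η for every belief π. -/
open scoped ENNReal

noncomputable section

variable {S A O : Type*}

/-- Approximate monotonicity of the dynamic-programming value functions: if the
expected terminal-cost contraction holds with slack `δ` under some policy `g̃`, then
`J_{k+1}^⋆(π) ≤ J_k^⋆(π) + α^k δ`; in particular, under Assumption 3 (slack
`δ = η/α^{N−1}`, horizon `N ≥ 1`) one gets `J_N^⋆(π) − J_{N−1}^⋆(π) ≤ η`. -/
theorem stmt_11 [Fintype S] [Fintype A] [Fintype O]
    [Nonempty S] [Nonempty A] [Nonempty O]
    (P : A → S → S → ℝ) (R : A → S → O → ℝ)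
    (hP : ∀ a i, (∀ j, 0 ≤ P a i j) ∧ ∑ j, P a i j = 1)
    (hR : ∀ a j, (∀ θ, 0 ≤ R a j θ) ∧ ∑ θ, R a j θ = 1)
    (c : A → S → ℝ) (hc : ∀ a i, 0 ≤ c a i)
    (cT : S → ℝ) (hcT : ∀ i, 0 ≤ cT i)
    (α : ℝ) (hα0 : 0 < α) (hα1 : α < 1)
    (δ : ℝ) (hδ : 0 ≤ δ) (gt : (S → ℝ) → A)
    (hassm : ∀ π ∈ stdSimplex ℝ S,
      α * ∑ i, ∑ j, π i * P (gt π) i j * cT j ≤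
        (∑ i, π i * (cT i - c (gt π) i)) + δ) :
    (∀ k : ℕ, ∀ π ∈ stdSimplex ℝ S,
        Jstar P R c cT α (k + 1) π ≤ Jstar P R c cT α k π + α ^ k * δ) ∧
      (∀ η : ℝ, 0 ≤ η → ∀ N : ℕ, 1 ≤ N → δ = η / α ^ (N - 1) →
        ∀ π ∈ stdSimplex ℝ S,
          Jstar P R c cT α N π - Jstar P R c cT α (N - 1) π ≤ η) := by
  have hterm : ∀ π ∈ stdSimplex ℝ S, ∀ a θ i j, 0 ≤ π i * P a i j * R a j θ :=
    fun π hπ a θ i j => mul_nonneg (mul_nonneg (hπ.1 i) ((hP a i).1 j)) ((hR a j).1 θ)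
  have hlik0 : ∀ π ∈ stdSimplex ℝ S, ∀ a θ, 0 ≤ lik P R π a θ := fun π hπ a θ =>
    Finset.sum_nonneg fun i _ => Finset.sum_nonneg fun j _ => hterm π hπ a θ i j
  have hlik' : ∀ (π : S → ℝ) a θ, lik P R π a θ = ∑ j, ∑ i, π i * P a i j * R a j θ :=
    fun π a θ => Finset.sum_comm
  have hsumR : ∀ (π : S → ℝ) a i j, ∑ θ, π i * P a i j * R a j θ = π i * P a i j := by
    intro π a i j
    rw [← Finset.mul_sum, (hR a j).2, mul_one]
  have hlik1 : ∀ π ∈ stdSimplex ℝ S, ∀ a, ∑ θ, lik P R π a θ = 1 := by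
    intro π hπ a
    unfold lik
    rw [Finset.sum_comm, ← hπ.2]
    refine Finset.sum_congr rfl fun i _ => ?_
    rw [Finset.sum_comm]
    simp only [hsumR]
    rw [← Finset.mul_sum, (hP a i).2, mul_one]
  have hupd : ∀ π ∈ stdSimplex ℝ S, ∀ a θ, upd P R π a θ ∈ stdSimplex ℝ S := by
    intro π hπ a θ
    unfold upd
    split_ifs with h
    · refine ⟨fun j => div_nonneg (Finset.sum_nonneg fun i _ => hterm π hπ a θ i j) h.le, ?_⟩
      rw [← Finset.sum_div, ← hlik', div_self h.ne']
    · exact hπ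
  have hmul : ∀ π ∈ stdSimplex ℝ S, ∀ a θ j,
      lik P R π a θ * upd P R π a θ j = ∑ i, π i * P a i j * R a j θ := by
    intro π hπ a θ j
    by_cases h : 0 < lik P R π a θ
    · simp only [upd, if_pos h]
      rw [mul_div_cancel₀ _ h.ne']
    · have h0 : lik P R π a θ = 0 := le_antisymm (not_lt.1 h) (hlik0 π hπ a θ)
      rw [h0, zero_mul]
      rw [hlik'] at h0
      exact ((Finset.sum_eq_zero_iff_of_nonneg fun j _ =>
        Finset.sum_nonneg fun i _ => hterm π hπ a θ i j).1 h0 j (Finset.mem_univ j)).symm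
  have hexp : ∀ π ∈ stdSimplex ℝ S, ∀ a,
      ∑ θ, lik P R π a θ * ∑ j, upd P R π a θ j * cT j = ∑ i, ∑ j, π i * P a i j * cT j := by
    intro π hπ a
    simp only [Finset.mul_sum, ← mul_assoc, hmul π hπ]
    conv_rhs => rw [Finset.sum_comm]
    rw [Finset.sum_comm]
    refine Finset.sum_congr rfl fun j _ => ?_
    rw [← Finset.sum_mul, Finset.sum_comm, ← Finset.sum_mul]
    simp only [hsumR]
  have main : ∀ k : ℕ, ∀ π ∈ stdSimplex ℝ S,
        Jstar P R c cT α (k + 1) π ≤ Jstar P R c cT α k π + α ^ k * δ := by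
    intro k
    induction k with
    | zero =>
      intro π hπ
      have h := hassm π hπ
      have h1 : Jstar P R c cT α (0 + 1) π ≤ _ :=
        ciInf_le (Set.finite_range _).bddBelow (gt π)
      simp only [Jstar, hexp π hπ] at h1 ⊢
      simp only [mul_sub, Finset.sum_sub_distrib] at h
      rw [pow_zero]
      linarith
    | succ k ih =>
      intro π hπ
      rw [← sub_le_iff_le_add]
      refine le_ciInf fun a => ?_
      rw [sub_le_iff_le_add]
      refine (ciInf_le (Set.finite_range _).bddBelow a).trans ?_
      have h : ∑ θ, lik P R π a θ * Jstar P R c cT α (k + 1) (upd P R π a θ) ≤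
          ∑ θ, lik P R π a θ * Jstar P R c cT α k (upd P R π a θ) + α ^ k * δ := by
        calc _ ≤ ∑ θ, lik P R π a θ * (Jstar P R c cT α k (upd P R π a θ) + α ^ k * δ) :=
              Finset.sum_le_sum fun θ _ =>
                mul_le_mul_of_nonneg_left (ih _ (hupd π hπ a θ)) (hlik0 π hπ a θ)
          _ = _ := by
              simp only [mul_add, Finset.sum_add_distrib]
              rw [← Finset.sum_mul, hlik1 π hπ a, one_mul]
      have h2 := mul_le_mul_of_nonneg_left h hα0.le
      rw [pow_succ]
      linarith
  refine ⟨main, ?_⟩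
  intro η _ N hN hd π hπ
  obtain ⟨n, rfl⟩ : ∃ n, N = n + 1 := ⟨N - 1, by omega⟩
  have h := main n π hπ
  rw [Nat.add_sub_cancel] at hd ⊢
  rw [hd, mul_div_cancel₀ _ (pow_pos hα0 n).ne'] at h
  linarith
end
end

section
/- In the POMDP control setting with discount α ∈ (0,1), suppose the exact terminal-cost contraction holds: there exists a policy g̃ : Δ(S) → A such that for every belief π ∈ Δ(S), α Σ_{i,j} π_i P(g̃(π))_{ij} cT_j ≤ Σ_i π_i (cT_i − c(g̃(π))_i). Then the dynamic-programming value functions are monotonically non-increasing in the horizon: J_{k+1}^⋆(π) ≤ J_k^⋆(π) for every k ∈ ℕ and every belief π ∈ Δ(S). -/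
open scoped ENNReal

noncomputable section

variable {S A O : Type*}

theorem lik_nonneg_aux [Fintype S] (P : A → S → S → ℝ) (R : A → S → O → ℝ)
    (hP : ∀ a i, (∀ j, 0 ≤ P a i j) ∧ ∑ j, P a i j = 1) (hR : ∀ a j θ, 0 ≤ R a j θ)
    (π : S → ℝ) (hπ : π ∈ stdSimplex ℝ S) (a : A) (θ : O) : 0 ≤ lik P R π a θ :=
  Finset.sum_nonneg fun i _ => Finset.sum_nonneg fun j _ =>
    mul_nonneg (mul_nonneg (hπ.1 i) ((hP a i).1 j)) (hR a j θ)

theorem upd_mem_aux [Fintype S] (P : A → S → S → ℝ) (R : A → S → O → ℝ)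
    (hP : ∀ a i, (∀ j, 0 ≤ P a i j) ∧ ∑ j, P a i j = 1) (hR : ∀ a j θ, 0 ≤ R a j θ)
    (π : S → ℝ) (hπ : π ∈ stdSimplex ℝ S) (a : A) (θ : O) :
    upd P R π a θ ∈ stdSimplex ℝ S := by
  unfold upd
  split_ifs with h
  · refine ⟨fun j => div_nonneg (Finset.sum_nonneg fun i _ =>
      mul_nonneg (mul_nonneg (hπ.1 i) ((hP a i).1 j)) (hR a j θ)) h.le, ?_⟩
    rw [← Finset.sum_div, Finset.sum_comm]
    exact div_self h.ne'
  · exact hπ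

theorem lik_mul_upd_aux [Fintype S] (P : A → S → S → ℝ) (R : A → S → O → ℝ)
    (hP : ∀ a i, (∀ j, 0 ≤ P a i j) ∧ ∑ j, P a i j = 1) (hR : ∀ a j θ, 0 ≤ R a j θ)
    (π : S → ℝ) (hπ : π ∈ stdSimplex ℝ S) (a : A) (θ : O) (j : S) :
    lik P R π a θ * upd P R π a θ j = ∑ i, π i * P a i j * R a j θ := by
  have hn : ∀ i j, 0 ≤ π i * P a i j * R a j θ := fun i j =>
    mul_nonneg (mul_nonneg (hπ.1 i) ((hP a i).1 j)) (hR a j θ)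
  by_cases h : 0 < lik P R π a θ
  · simp only [upd, if_pos h]
    exact mul_div_cancel₀ _ h.ne'
  · have h0 : lik P R π a θ = 0 := le_antisymm (not_lt.mp h) (lik_nonneg_aux P R hP hR π hπ a θ)
    rw [h0, zero_mul]
    symm
    apply Finset.sum_eq_zero
    intro i _
    have h1 := (Finset.sum_eq_zero_iff_of_nonneg
      (fun i _ => Finset.sum_nonneg fun j _ => hn i j)).1 h0 i (Finset.mem_univ i)
    exact (Finset.sum_eq_zero_iff_of_nonneg (fun j _ => hn i j)).1 h1 j (Finset.mem_univ j)

/-- Under the exact expected terminal-cost contraction, the dynamic-programming value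
functions are monotonically non-increasing in the horizon: `J_{k+1}^⋆(π) ≤ J_k^⋆(π)`. -/
theorem stmt_12 [Fintype S] [Fintype A] [Fintype O]
    [Nonempty S] [Nonempty A] [Nonempty O]
    (P : A → S → S → ℝ) (R : A → S → O → ℝ)
    (hP : ∀ a i, (∀ j, 0 ≤ P a i j) ∧ ∑ j, P a i j = 1)
    (hR : ∀ a j, (∀ θ, 0 ≤ R a j θ) ∧ ∑ θ, R a j θ = 1)
    (c : A → S → ℝ) (hc : ∀ a i, 0 ≤ c a i)
    (cT : S → ℝ) (hcT : ∀ i, 0 ≤ cT i)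
    (α : ℝ) (hα0 : 0 < α) (hα1 : α < 1)
    (gt : (S → ℝ) → A)
    (hassm : ∀ π ∈ stdSimplex ℝ S,
      α * ∑ i, ∑ j, π i * P (gt π) i j * cT j ≤
        ∑ i, π i * (cT i - c (gt π) i))
    (k : ℕ) (π : S → ℝ) (hπ : π ∈ stdSimplex ℝ S) :
    Jstar P R c cT α (k + 1) π ≤ Jstar P R c cT α k π := by
  have hR' : ∀ a j θ, 0 ≤ R a j θ := fun a j => (hR a j).1
  induction k generalizing π with
  | zero =>
    have h := hassm π hπ
    have key : ∑ θ, lik P R π (gt π) θ * Jstar P R c cT α 0 (upd P R π (gt π) θ)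
        = ∑ i, ∑ j, π i * P (gt π) i j * cT j := by
      have h1 : ∀ θ, lik P R π (gt π) θ * Jstar P R c cT α 0 (upd P R π (gt π) θ)
          = ∑ j, (∑ i, π i * P (gt π) i j) * cT j * R (gt π) j θ := by
        intro θ
        rw [Jstar, Finset.mul_sum]
        refine Finset.sum_congr rfl fun j _ => ?_
        rw [← mul_assoc, lik_mul_upd_aux P R hP hR' π hπ, ← Finset.sum_mul]
        ring
      simp_rw [h1]
      rw [Finset.sum_comm, Finset.sum_comm (f := fun i j => π i * P (gt π) i j * cT j)]
      refine Finset.sum_congr rfl fun j _ => ?_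
      rw [← Finset.mul_sum, (hR (gt π) j).2, mul_one, Finset.sum_mul]
    rw [Jstar]
    refine (ciInf_le (Set.finite_range _).bddBelow (gt π)).trans ?_
    rw [key]
    change _ ≤ ∑ j, π j * cT j
    simp only [mul_sub, Finset.sum_sub_distrib] at h
    linarith
  | succ k ih =>
    have e : ∀ k π, Jstar P R c cT α (k + 1) π = ⨅ a : A, (∑ i, π i * c a i +
      α * ∑ θ, lik P R π a θ * Jstar P R c cT α k (upd P R π a θ)) := fun _ _ => rfl
    rw [e (k + 1) π, e k π]
    refine ciInf_mono (Set.finite_range _).bddBelow fun a => ?_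
    have h : ∑ θ, lik P R π a θ * Jstar P R c cT α (k + 1) (upd P R π a θ)
        ≤ ∑ θ, lik P R π a θ * Jstar P R c cT α k (upd P R π a θ) :=
      Finset.sum_le_sum fun θ _ => mul_le_mul_of_nonneg_left
        (ih _ (upd_mem_aux P R hP hR' π hπ a θ)) (lik_nonneg_aux P R hP hR' π hπ a θ)
    have := mul_le_mul_of_nonneg_left h hα0.le
    linarith
end
end

section
/- In the POMDP control setting with discount α ∈ (0,1), suppose the exact terminal-cost contraction holds: there exists a policy g̃ : Δ(S) → A such that for every belief π ∈ Δ(S), α Σ_{i,j} π_i P(g̃(π))_{ij} cT_j ≤ Σ_i π_i (cT_i − c(g̃(π))_i). Then the terminal cost dominates every finite-horizon value function: J_k^⋆(π) ≤ Σ_i π_i cT_i for every k ∈ ℕ and every belief π ∈ Δ(S). -/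
open scoped ENNReal

noncomputable section

variable {S A O : Type*}

/-- Under the exact expected terminal-cost contraction, the terminal cost dominates
every finite-horizon value function: `J_k^⋆(π) ≤ π cT`. -/
theorem stmt_13 [Fintype S] [Fintype A] [Fintype O]
    [Nonempty S] [Nonempty A] [Nonempty O]
    (P : A → S → S → ℝ) (R : A → S → O → ℝ)
    (hP : ∀ a i, (∀ j, 0 ≤ P a i j) ∧ ∑ j, P a i j = 1)
    (hR : ∀ a j, (∀ θ, 0 ≤ R a j θ) ∧ ∑ θ, R a j θ = 1)
    (c : A → S → ℝ) (hc : ∀ a i, 0 ≤ c a i)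
    (cT : S → ℝ) (hcT : ∀ i, 0 ≤ cT i)
    (α : ℝ) (hα0 : 0 < α) (hα1 : α < 1)
    (gt : (S → ℝ) → A)
    (hassm : ∀ π ∈ stdSimplex ℝ S,
      α * ∑ i, ∑ j, π i * P (gt π) i j * cT j ≤
        ∑ i, π i * (cT i - c (gt π) i))
    (k : ℕ) (π : S → ℝ) (hπ : π ∈ stdSimplex ℝ S) :
    Jstar P R c cT α k π ≤ ∑ i, π i * cT i := by
  induction k generalizing π with
  | zero => simp [Jstar]
  | succ k ih =>
    have hπ0 := hπ.1
    have key : ∀ θ, lik P R π (gt π) θ * Jstar P R c cT α k (upd P R π (gt π) θ) ≤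
        ∑ j, (∑ i, π i * P (gt π) i j * R (gt π) j θ) * cT j := by
      intro θ
      have hn : ∀ i j, 0 ≤ π i * P (gt π) i j * R (gt π) j θ := fun i j =>
        mul_nonneg (mul_nonneg (hπ0 i) ((hP _ i).1 j)) ((hR _ j).1 θ)
      have hl : 0 ≤ lik P R π (gt π) θ :=
        Finset.sum_nonneg fun i _ => Finset.sum_nonneg fun j _ => hn i j
      rcases hl.lt_or_eq with h | h
      · have hu : upd P R π (gt π) θ =
            fun j => (∑ i, π i * P (gt π) i j * R (gt π) j θ) / lik P R π (gt π) θ := by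
          simp [upd, h]
        have hm : upd P R π (gt π) θ ∈ stdSimplex ℝ S := by
          rw [hu]
          refine ⟨fun j => div_nonneg (Finset.sum_nonneg fun i _ => hn i j) hl, ?_⟩
          rw [← Finset.sum_div, Finset.sum_comm]
          exact div_self h.ne'
        refine (mul_le_mul_of_nonneg_left (ih _ hm) hl).trans_eq ?_
        rw [hu, Finset.mul_sum]
        refine Finset.sum_congr rfl fun j _ => ?_
        rw [← mul_assoc, mul_div_cancel₀ _ h.ne']
      · rw [← h, zero_mul]
        exact Finset.sum_nonneg fun j _ =>
          mul_nonneg (Finset.sum_nonneg fun i _ => hn i j) (hcT j)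
    have hsum : ∑ θ, ∑ j, (∑ i, π i * P (gt π) i j * R (gt π) j θ) * cT j =
        ∑ i, ∑ j, π i * P (gt π) i j * cT j := by
      rw [Finset.sum_comm, Finset.sum_comm (f := fun i j => π i * P (gt π) i j * cT j)]
      refine Finset.sum_congr rfl fun j _ => ?_
      rw [← Finset.sum_mul, Finset.sum_comm, Finset.sum_mul]
      refine Finset.sum_congr rfl fun i _ => ?_
      rw [← Finset.mul_sum, (hR _ j).2, mul_one]
    have h1 := mul_le_mul_of_nonneg_left
      (Finset.sum_le_sum fun θ (_ : θ ∈ Finset.univ) => key θ) hα0.le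
    rw [hsum] at h1
    have h2 := hassm π hπ
    simp only [mul_sub, Finset.sum_sub_distrib] at h2
    rw [Jstar]
    refine (ciInf_le (Set.finite_range _).bddBelow (gt π)).trans ?_
    linarith
end
end
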